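/- arXiv:2412.13874 — 7 statements merged into one kernel-verified Lean document; each statement's English description precedes it below -/
import Mathlib

section
/- For every integer n ≥ 3 and all complex numbers x, y, z, t with x, y, z pairwise distinct and each distinct from t, one has ∑_{p₁=1}^{n−2} ∑_{p₂=1}^{p₁} 1/((t−x)^{p₂} (t−y)^{p₁−p₂+1} (t−z)^{n−p₁−1}) = 1/((z−y)(z−x)(t−z)^{n−2}) + 1/((y−x)(y−z)(t−y)^{n−2}) + 1/((x−y)(x−z)(t−x)^{n−2}). -/
/-- The complete homogeneous sum in two inverse variables, in closed form. -/
theorem sum_Icc_one_div_pow_mul_pow {K : Type*} [Field K] {a b : K} (ha : a ≠ 0) (hb : b ≠ 0)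
    (hab : a ≠ b) (m : ℕ) :
    ∑ p ∈ Finset.Icc 1 m, 1 / (a ^ p * b ^ (m - p + 1)) = (1 / b ^ m - 1 / a ^ m) / (a - b) := by
  have h₁ : a - b ≠ 0 := sub_ne_zero.mpr hab
  induction m with
  | zero => simp
  | succ m ih =>
    have hstep : ∑ p ∈ Finset.Icc 1 m, 1 / (a ^ p * b ^ (m + 1 - p + 1))
        = (∑ p ∈ Finset.Icc 1 m, 1 / (a ^ p * b ^ (m - p + 1))) / b := by
      rw [Finset.sum_div]
      refine Finset.sum_congr rfl fun p hp => ?_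
      have hpm : m + 1 - p + 1 = (m - p + 1) + 1 := by
        have := (Finset.mem_Icc.mp hp).2
        omega
      rw [hpm, pow_succ b, ← mul_assoc, div_div]
    rw [Finset.sum_Icc_succ_top (by omega), hstep, ih, Nat.sub_self, zero_add]
    field_simp
    ring

/-- The complete homogeneous sum in three inverse variables, in closed form. -/
theorem sum_Icc_sum_Icc_one_div_pow {K : Type*} [Field K] {a b c : K} (ha : a ≠ 0) (hb : b ≠ 0)
    (hc : c ≠ 0) (hab : a ≠ b) (hac : a ≠ c) (hbc : b ≠ c) (m : ℕ) :
    ∑ q ∈ Finset.Icc 1 m, ∑ p ∈ Finset.Icc 1 q,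
        1 / (a ^ p * b ^ (q - p + 1) * c ^ (m + 1 - q))
      = 1 / ((b - c) * (a - c) * c ^ m) - 1 / ((a - b) * (b - c) * b ^ m)
        + 1 / ((a - b) * (a - c) * a ^ m) := by
  have h₁ : a - b ≠ 0 := sub_ne_zero.mpr hab
  have h₂ : a - c ≠ 0 := sub_ne_zero.mpr hac
  have h₃ : b - c ≠ 0 := sub_ne_zero.mpr hbc
  induction m with
  | zero =>
    simp only [Finset.Icc_eq_empty_of_lt zero_lt_one, Finset.sum_empty, pow_zero]
    field_simp
    ring
  | succ m ih =>
    have hstep : ∑ q ∈ Finset.Icc 1 m, ∑ p ∈ Finset.Icc 1 q,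
          1 / (a ^ p * b ^ (q - p + 1) * c ^ (m + 1 + 1 - q))
        = (∑ q ∈ Finset.Icc 1 m, ∑ p ∈ Finset.Icc 1 q,
          1 / (a ^ p * b ^ (q - p + 1) * c ^ (m + 1 - q))) / c := by
      rw [Finset.sum_div]
      refine Finset.sum_congr rfl fun q hq => ?_
      rw [Finset.sum_div]
      have hqm : m + 1 + 1 - q = (m + 1 - q) + 1 := by
        have := (Finset.mem_Icc.mp hq).2
        omega
      refine Finset.sum_congr rfl fun p _ => ?_
      rw [hqm, pow_succ c, ← mul_assoc, div_div]
    have htop : ∑ p ∈ Finset.Icc 1 (m + 1),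
          1 / (a ^ p * b ^ (m + 1 - p + 1) * c ^ (m + 1 + 1 - (m + 1)))
        = (1 / b ^ (m + 1) - 1 / a ^ (m + 1)) / (a - b) / c := by
      rw [← sum_Icc_one_div_pow_mul_pow ha hb hab, Finset.sum_div]
      refine Finset.sum_congr rfl fun p _ => ?_
      rw [Nat.add_sub_cancel_left, pow_one, div_div]
    rw [Finset.sum_Icc_succ_top (by omega), hstep, ih, htop]
    field_simp
    ring

/-- Third symmetrization identity: for `n ≥ 3` and pairwise distinct complex numbers,
`∑_{p₁=1}^{n−2} ∑_{p₂=1}^{p₁} 1/((t−x)^{p₂} (t−y)^{p₁−p₂+1} (t−z)^{n−p₁−1})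
  = 1/((z−y)(z−x)(t−z)^{n−2}) + 1/((y−x)(y−z)(t−y)^{n−2}) + 1/((x−y)(x−z)(t−x)^{n−2})`. -/
theorem symmetrization_identity_three (n : ℕ) (hn : 3 ≤ n) (x y z t : ℂ)
    (hxy : x ≠ y) (hxz : x ≠ z) (hyz : y ≠ z)
    (hxt : x ≠ t) (hyt : y ≠ t) (hzt : z ≠ t) :
    ∑ p₁ ∈ Finset.Icc 1 (n - 2), ∑ p₂ ∈ Finset.Icc 1 p₁,
        1 / ((t - x) ^ p₂ * (t - y) ^ (p₁ - p₂ + 1) * (t - z) ^ (n - p₁ - 1))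
      = 1 / ((z - y) * (z - x) * (t - z) ^ (n - 2))
        + 1 / ((y - x) * (y - z) * (t - y) ^ (n - 2))
        + 1 / ((x - y) * (x - z) * (t - x) ^ (n - 2)) := by
  obtain ⟨m, rfl⟩ : ∃ m, n = m + 2 := ⟨n - 2, by omega⟩
  have key := sum_Icc_sum_Icc_one_div_pow (sub_ne_zero.mpr hxt.symm) (sub_ne_zero.mpr hyt.symm)
    (sub_ne_zero.mpr hzt.symm) (sub_right_injective.ne hxy) (sub_right_injective.ne hxz)
    (sub_right_injective.ne hyz) m
  have hexp (q : ℕ) : m + 2 - q - 1 = m + 1 - q := by omega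
  simp only [Nat.add_sub_cancel, hexp]
  rw [key, sub_sub_sub_cancel_left, sub_sub_sub_cancel_left, sub_sub_sub_cancel_left,
    ← neg_sub z y, ← neg_sub y x, ← neg_sub z x]
  simp only [mul_neg, neg_mul, neg_neg, div_neg]
  ring
end

section
/- For all β ∈ ℝ², all real numbers q and γ, and each i ∈ {1,2}, one has q·B(β, γe_i) + 2·C(β, β, γe_i) = h₂(e_i) · (q − 2ω_{î}(β)) · ⟨β, γe_i⟩, where î = 3−i. -/
open RealInnerProductSpace

noncomputable section
namespace Toda

/-- The ambient space `ℝ²` with its standard inner product. -/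
abbrev V : Type := EuclideanSpace ℝ (Fin 2)

/-- `h₁ = (2e₁+e₂)/3`, first fundamental weight of `sl₃`. -/
def h1vec (e₁ e₂ : V) : V := (3:ℝ)⁻¹ • ((2:ℝ) • e₁ + e₂)

/-- `h₂ = (−e₁+e₂)/3`. -/
def h2vec (e₁ e₂ : V) : V := (3:ℝ)⁻¹ • (-e₁ + e₂)

/-- `h₃ = −(e₁+2e₂)/3`. -/
def h3vec (e₁ e₂ : V) : V := -((3:ℝ)⁻¹ • (e₁ + (2:ℝ) • e₂))

/-- `h₁(u) = ⟨h₁, u⟩`. -/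
def H1 (e₁ e₂ u : V) : ℝ := ⟪h1vec e₁ e₂, u⟫

/-- `h₂(u) = ⟨h₂, u⟩`. -/
def H2 (e₁ e₂ u : V) : ℝ := ⟪h2vec e₁ e₂, u⟫

/-- `h₃(u) = ⟨h₃, u⟩`. -/
def H3 (e₁ e₂ u : V) : ℝ := ⟪h3vec e₁ e₂, u⟫

/-- The fundamental weights `ω₁ = (2e₁+e₂)/3` and `ω₂ = (e₁+2e₂)/3`, indexed by `Fin 2`
(so index `0` is `ω₁` and index `1` is `ω₂`). -/
def ωvec (e₁ e₂ : V) (i : Fin 2) : V :=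
  if i = 0 then (3:ℝ)⁻¹ • ((2:ℝ) • e₁ + e₂) else (3:ℝ)⁻¹ • (e₁ + (2:ℝ) • e₂)

/-- `ωᵢ(u) = ⟨ωᵢ, u⟩`. -/
def ωf (e₁ e₂ : V) (i : Fin 2) (u : V) : ℝ := ⟪ωvec e₁ e₂ i, u⟫

/-- `B(u,v) = (h₂(u)−h₁(u))h₁(v) + (h₃(u)−h₂(u))h₃(v)`. -/
def B (e₁ e₂ u v : V) : ℝ :=
  (H2 e₁ e₂ u - H1 e₁ e₂ u) * H1 e₁ e₂ v + (H3 e₁ e₂ u - H2 e₁ e₂ u) * H3 e₁ e₂ v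

/-- `C(u,v,w) = h₁(u)h₂(v)h₃(w) + h₁(v)h₂(w)h₃(u) + h₁(w)h₂(u)h₃(v)`. -/
def C (e₁ e₂ u v w : V) : ℝ :=
  H1 e₁ e₂ u * H2 e₁ e₂ v * H3 e₁ e₂ w + H1 e₁ e₂ v * H2 e₁ e₂ w * H3 e₁ e₂ u
    + H1 e₁ e₂ w * H2 e₁ e₂ u * H3 e₁ e₂ v

/-- The simple roots indexed by `Fin 2` (index `0` is `e₁`, index `1` is `e₂`). -/
def ev (e₁ e₂ : V) (i : Fin 2) : V := if i = 0 then e₁ else e₂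

/-- `q·B(β, γeᵢ) + 2·C(β, β, γeᵢ) = h₂(eᵢ)·(q − 2ω_î(β))·⟨β, γeᵢ⟩` with `î = 3−i`
(indices in `Fin 2`: `i` is the paper index `i+1` and `î` corresponds to `1−i`). -/
theorem W_minus_one_coefficient (e₁ e₂ : V)
    (h11 : ⟪e₁, e₁⟫ = 2) (h22 : ⟪e₂, e₂⟫ = 2) (h12 : ⟪e₁, e₂⟫ = -1)
    (β : V) (q γ : ℝ) (i : Fin 2) :
    q * B e₁ e₂ β (γ • ev e₁ e₂ i) + 2 * C e₁ e₂ β β (γ • ev e₁ e₂ i)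
      = H2 e₁ e₂ (ev e₁ e₂ i) * (q - 2 * ωf e₁ e₂ (1 - i) β) * ⟪β, γ • ev e₁ e₂ i⟫ := by
  have h21 : ⟪e₂, e₁⟫ = -1 := by rw [real_inner_comm, h12]
  fin_cases i <;>
    simp [B, C, H1, H2, H3, h1vec, h2vec, h3vec, ωf, ωvec, ev, inner_add_left, inner_neg_left,
      real_inner_smul_left, real_inner_smul_right,
      -inner_self_eq_norm_sq_to_K, h11, h22, h12, h21, real_inner_comm e₁ β,
      real_inner_comm e₂ β] <;>
    ring

end Toda
end
end

section
/- For all α, β ∈ ℝ², every real number γ, and each i ∈ {1,2}, one has Cσ(β, γe_i, α) = −h₂(e_i) · ( ω_{î}(α)·⟨β, γe_i⟩ + ω_{î}(β)·⟨α, γe_i⟩ ), where î = 3−i and Cσ(u,v,w) = C(u,v,w) + C(u,w,v). -/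
open RealInnerProductSpace

noncomputable section
namespace Toda

/-- `Cσ(β, γeᵢ, α) = −h₂(eᵢ)·(ω_î(α)⟨β, γeᵢ⟩ + ω_î(β)⟨α, γeᵢ⟩)` with `î = 3−i`,
where `Cσ(u,v,w) = C(u,v,w) + C(u,w,v)`. -/
theorem Csigma_beta_gamma_alpha (e₁ e₂ : V)
    (h11 : ⟪e₁, e₁⟫ = 2) (h22 : ⟪e₂, e₂⟫ = 2) (h12 : ⟪e₁, e₂⟫ = -1)
    (α β : V) (γ : ℝ) (i : Fin 2) :
    C e₁ e₂ β (γ • ev e₁ e₂ i) α + C e₁ e₂ β α (γ • ev e₁ e₂ i)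
      = -(H2 e₁ e₂ (ev e₁ e₂ i))
          * (ωf e₁ e₂ (1 - i) α * ⟪β, γ • ev e₁ e₂ i⟫ + ωf e₁ e₂ (1 - i) β * ⟪α, γ • ev e₁ e₂ i⟫) := by
  have h21 : ⟪e₂, e₁⟫ = -1 := by rw [real_inner_comm]; exact h12
  rw [real_inner_self_eq_norm_sq] at h11 h22
  fin_cases i <;>
    simp [C, H1, H2, H3, h1vec, h2vec, h3vec, ωf, ωvec, ev, inner_add_left, inner_neg_left,
      inner_smul_left, inner_smul_right, h11, h22, h12, h21, real_inner_comm e₁ α,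
      real_inner_comm e₁ β, real_inner_comm e₂ α, real_inner_comm e₂ β] <;>
    ring

end Toda
end
end

section
/- For all α ∈ ℝ², every nonzero real number γ, with q = γ + 2/γ, and each i ∈ {1,2}, one has q·B(γe_i, α) + 2·C(γe_i, γe_i, α) = q·h₂(e_i)·⟨γe_i, α⟩ + 4·h₂(e_i)·ω_{î}(α), where î = 3−i. -/
open RealInnerProductSpace

noncomputable section
namespace Toda

/-- `q·B(γeᵢ, α) + 2·C(γeᵢ, γeᵢ, α) = q·h₂(eᵢ)·⟨γeᵢ, α⟩ + 4·h₂(eᵢ)·ω_î(α)`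
with `q = γ + 2/γ` and `î = 3−i`. -/
theorem B_C_gamma_alpha (e₁ e₂ : V)
    (h11 : ⟪e₁, e₁⟫ = 2) (h22 : ⟪e₂, e₂⟫ = 2) (h12 : ⟪e₁, e₂⟫ = -1)
    (α : V) (γ : ℝ) (hγ : γ ≠ 0) (q : ℝ) (hq : q = γ + 2 / γ) (i : Fin 2) :
    q * B e₁ e₂ (γ • ev e₁ e₂ i) α + 2 * C e₁ e₂ (γ • ev e₁ e₂ i) (γ • ev e₁ e₂ i) α
      = q * H2 e₁ e₂ (ev e₁ e₂ i) * ⟪γ • ev e₁ e₂ i, α⟫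
        + 4 * H2 e₁ e₂ (ev e₁ e₂ i) * ωf e₁ e₂ (1 - i) α := by
  have h21 : ⟪e₂, e₁⟫ = -1 := by rw [real_inner_comm, h12]
  have hqγ : q * γ = γ ^ 2 + 2 := by
    rw [hq]
    field_simp
  fin_cases i
  · simp [-inner_self_eq_norm_sq_to_K, B, C, H1, H2, H3, h1vec, h2vec,
      h3vec, ωf, ωvec, ev,
      inner_add_left, inner_neg_left,
      real_inner_smul_left, real_inner_smul_right, h11, h21]
    linear_combination (-2 / 3 * ⟪e₁, α⟫ - 4 / 3 * ⟪e₂, α⟫) * hqγ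
  · simp [-inner_self_eq_norm_sq_to_K, B, C, H1, H2, H3, h1vec, h2vec,
      h3vec, ωf, ωvec, ev,
      inner_add_left, inner_neg_left,
      real_inner_smul_left, real_inner_smul_right, h12, h22]
    linear_combination (4 / 3 * ⟪e₁, α⟫ + 2 / 3 * ⟪e₂, α⟫) * hqγ

end Toda
end
end

section
/- For all α ∈ ℝ², every nonzero real number γ, with q = γ + 2/γ, and each i ∈ {1,2}, one has q·(B(α, γe_i) − B(γe_i, α)) + 2·C(α − γe_i, α, γe_i) = −4·h₂(e_i)·ω_{î}(α)·(1 + ⟨γe_i, α⟩/2), where î = 3−i. -/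
open RealInnerProductSpace

noncomputable section
namespace Toda

/-- `q·(B(α, γeᵢ) − B(γeᵢ, α)) + 2·C(α − γeᵢ, α, γeᵢ) = −4·h₂(eᵢ)·ω_î(α)·(1 + ⟨γeᵢ, α⟩/2)`
with `q = γ + 2/γ` and `î = 3−i`. -/
theorem B_C_antisymmetric_combination (e₁ e₂ : V)
    (h11 : ⟪e₁, e₁⟫ = 2) (h22 : ⟪e₂, e₂⟫ = 2) (h12 : ⟪e₁, e₂⟫ = -1)
    (α : V) (γ : ℝ) (hγ : γ ≠ 0) (q : ℝ) (hq : q = γ + 2 / γ) (i : Fin 2) :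
    q * (B e₁ e₂ α (γ • ev e₁ e₂ i) - B e₁ e₂ (γ • ev e₁ e₂ i) α)
        + 2 * C e₁ e₂ (α - γ • ev e₁ e₂ i) α (γ • ev e₁ e₂ i)
      = -4 * H2 e₁ e₂ (ev e₁ e₂ i) * ωf e₁ e₂ (1 - i) α * (1 + ⟪γ • ev e₁ e₂ i, α⟫ / 2) := by
  have h21 : ⟪e₂, e₁⟫ = -1 := by rw [real_inner_comm, h12]
  subst hq
  fin_cases i <;>
    simp [B, C, H1, H2, H3, h1vec, h2vec, h3vec, ωf, ωvec, ev, inner_add_left, inner_neg_left,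
      inner_smul_left, inner_smul_right, inner_sub_right, h11, h12, h21, h22,
      -inner_self_eq_norm_sq_to_K] <;>
    field_simp <;>
    ring

end Toda
end
end

section
/- For all β ∈ ℝ², every nonzero real number γ, with q = γ + 2/γ, every integer n ≥ 3, and all i, j ∈ {1,2}, one has (n−2)·( (q/2)·B(γe_i, γe_j) + C(γe_i, γe_i, γe_j) ) − C(γe_i, γe_j, β) − C(γe_j, γe_i, β) = 2γ·h₂(e_i)·[i ≠ j]·( (n−2) + ⟨γe_i, β⟩/2 ) + h₂(e_i)·( (n−2)q + 2ω_{î}(β) )·⟨γe_i, γe_j⟩/2, where [i ≠ j] equals 1 if i ≠ j and 0 otherwise, and î = 3−i. -/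
open RealInnerProductSpace

noncomputable section
namespace Toda

/-- `(n−2)((q/2)B(γeᵢ, γeⱼ) + C(γeᵢ, γeᵢ, γeⱼ)) − C(γeᵢ, γeⱼ, β) − C(γeⱼ, γeᵢ, β)
  = 2γ·h₂(eᵢ)·[i ≠ j]·((n−2) + ⟨γeᵢ, β⟩/2) + h₂(eᵢ)·((n−2)q + 2ω_î(β))·⟨γeᵢ, γeⱼ⟩/2`
with `q = γ + 2/γ`, `n ≥ 3` and `î = 3−i`. -/
theorem two_fold_coefficient_identity (e₁ e₂ : V)
    (h11 : ⟪e₁, e₁⟫ = 2) (h22 : ⟪e₂, e₂⟫ = 2) (h12 : ⟪e₁, e₂⟫ = -1)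
    (β : V) (γ : ℝ) (hγ : γ ≠ 0) (q : ℝ) (hq : q = γ + 2 / γ)
    (n : ℕ) (hn : 3 ≤ n) (i j : Fin 2) :
    ((n : ℝ) - 2) * ((q / 2) * B e₁ e₂ (γ • ev e₁ e₂ i) (γ • ev e₁ e₂ j)
          + C e₁ e₂ (γ • ev e₁ e₂ i) (γ • ev e₁ e₂ i) (γ • ev e₁ e₂ j))
        - C e₁ e₂ (γ • ev e₁ e₂ i) (γ • ev e₁ e₂ j) β
        - C e₁ e₂ (γ • ev e₁ e₂ j) (γ • ev e₁ e₂ i) β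
      = 2 * γ * H2 e₁ e₂ (ev e₁ e₂ i) * (if i ≠ j then (1:ℝ) else 0)
          * (((n : ℝ) - 2) + ⟪γ • ev e₁ e₂ i, β⟫ / 2)
        + H2 e₁ e₂ (ev e₁ e₂ i) * (((n : ℝ) - 2) * q + 2 * ωf e₁ e₂ (1 - i) β)
          * ⟪γ • ev e₁ e₂ i, γ • ev e₁ e₂ j⟫ / 2 := by
  have h21 : ⟪e₂, e₁⟫ = -1 := by rw [real_inner_comm]; exact h12
  have hqγ : q * γ = γ ^ 2 + 2 := by
    rw [hq]
    field_simp
  fin_cases i <;> fin_cases j <;>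
    simp [-inner_self_eq_norm_sq_to_K, B, C, H1, H2, H3, h1vec, h2vec, h3vec, ωf, ωvec, ev,
      inner_add_left, inner_neg_left, real_inner_smul_left, real_inner_smul_right,
      h11, h22, h12, h21]
  · ring
  · linear_combination (-((n : ℝ) - 2) * γ) * hqγ
  · linear_combination (((n : ℝ) - 2) * γ) * hqγ
  · ring

end Toda
end
end

section
/- For every nonzero real number γ, with q = γ + 2/γ, and all i, j ∈ {1,2}, one has (q/2)·(B(γe_i, γe_j) − B(γe_j, γe_i)) + C(γe_i, γe_i, γe_j) − C(γe_j, γe_j, γe_i) = 2γ·h₂(e_i)·(1 + ⟨γe_i, γe_j⟩/2)·[i ≠ j], where [i ≠ j] equals 1 if i ≠ j and 0 otherwise. -/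
open RealInnerProductSpace

noncomputable section
namespace Toda

/-- Values of the weights `h₁, h₂, h₃` on multiples of the simple roots. -/
theorem H_smul_simpleRoot (e₁ e₂ : V)
    (h11 : ⟪e₁, e₁⟫ = 2) (h22 : ⟪e₂, e₂⟫ = 2) (h12 : ⟪e₁, e₂⟫ = -1) (c : ℝ) :
    (H1 e₁ e₂ (c • e₁) = c ∧ H2 e₁ e₂ (c • e₁) = -c ∧ H3 e₁ e₂ (c • e₁) = 0) ∧
      (H1 e₁ e₂ (c • e₂) = 0 ∧ H2 e₁ e₂ (c • e₂) = c ∧ H3 e₁ e₂ (c • e₂) = -c) := by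
  have h21 : ⟪e₂, e₁⟫ = -1 := by rw [real_inner_comm, h12]
  simp only [H1, H2, H3, h1vec, h2vec, h3vec, inner_add_left, inner_neg_left,
    real_inner_smul_left, real_inner_smul_right, h11, h22, h12, h21]
  refine ⟨⟨?_, ?_, ?_⟩, ?_, ?_, ?_⟩ <;> ring

/-- `(q/2)(B(γeᵢ, γeⱼ) − B(γeⱼ, γeᵢ)) + C(γeᵢ, γeᵢ, γeⱼ) − C(γeⱼ, γeⱼ, γeᵢ)
  = 2γ·h₂(eᵢ)·(1 + ⟨γeᵢ, γeⱼ⟩/2)·[i ≠ j]` with `q = γ + 2/γ`. -/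
theorem antisymmetric_gamma_identity (e₁ e₂ : V)
    (h11 : ⟪e₁, e₁⟫ = 2) (h22 : ⟪e₂, e₂⟫ = 2) (h12 : ⟪e₁, e₂⟫ = -1)
    (γ : ℝ) (hγ : γ ≠ 0) (q : ℝ) (hq : q = γ + 2 / γ) (i j : Fin 2) :
    (q / 2) * (B e₁ e₂ (γ • ev e₁ e₂ i) (γ • ev e₁ e₂ j)
          - B e₁ e₂ (γ • ev e₁ e₂ j) (γ • ev e₁ e₂ i))
        + C e₁ e₂ (γ • ev e₁ e₂ i) (γ • ev e₁ e₂ i) (γ • ev e₁ e₂ j)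
        - C e₁ e₂ (γ • ev e₁ e₂ j) (γ • ev e₁ e₂ j) (γ • ev e₁ e₂ i)
      = 2 * γ * H2 e₁ e₂ (ev e₁ e₂ i) * (1 + ⟪γ • ev e₁ e₂ i, γ • ev e₁ e₂ j⟫ / 2)
          * (if i ≠ j then (1:ℝ) else 0) := by
  have h21 : ⟪e₂, e₁⟫ = -1 := by rw [real_inner_comm, h12]
  obtain ⟨⟨a1, a2, a3⟩, b1, b2, b3⟩ := H_smul_simpleRoot e₁ e₂ h11 h22 h12 γ
  obtain ⟨⟨-, a, -⟩, -, b, -⟩ := H_smul_simpleRoot e₁ e₂ h11 h22 h12 1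
  rw [one_smul] at a b
  subst hq
  fin_cases i <;> fin_cases j <;>
    simp [ev, B, C, a1, a2, a3, b1, b2, b3, a, b, real_inner_smul_left,
      real_inner_smul_right, h12, h21]
  all_goals
    field_simp
    ring

end Toda
end
end
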